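/- Let n ≥ 4 and let r = (r_1,…,r_n) have positive real entries. Consider the map which assigns to each closed n-gon (e_1,…,e_n) with side lengths r the vector of diagonal lengths (‖e_1 + e_2‖, ‖e_1 + e_2 + e_3‖, …, ‖e_1 + ⋯ + e_{n−2}‖) ∈ ℝ^{n−3}. Then the image of this map, over all closed n-gons with side lengths r, is exactly the set Δ_cat(r) of points satisfying the triangle inequalities; in particular the image is a convex polytope. -/

import Mathlib

/-- The extended sequence of diagonal lengths `d_0, d_1, …, d_{n-2}` (one-indexed in the paper),
with the conventions `d_0 = r_1` and `d_{n-2} = r_n`; here `d : Fin (n-3) → ℝ` stores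
`d_1, …, d_{n-3}` (zero-indexed). -/
def diagSeq {n : ℕ} (hn : 4 ≤ n) (r : Fin n → ℝ) (d : Fin (n - 3) → ℝ) : ℕ → ℝ :=
  fun i =>
    if h0 : i = 0 then r ⟨0, by omega⟩
    else if h : i < n - 2 then d ⟨i - 1, by omega⟩
    else r ⟨n - 1, by omega⟩

/-- The caterpillar polytope `Δ_cat(r) ⊆ ℝ^{n-3}`: with `d_0 = r_1`, `d_{n-2} = r_n`, for every
`i = 0, …, n-3` the triangle inequalities for `(r_{i+2}, d_i, d_{i+1})` hold (one-indexed). -/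
def DeltaCat {n : ℕ} (hn : 4 ≤ n) (r : Fin n → ℝ) : Set (Fin (n - 3) → ℝ) :=
  {d | ∀ i : ℕ, ∀ _hi : i ≤ n - 3,
        r ⟨i + 1, by omega⟩ ≤ diagSeq hn r d i + diagSeq hn r d (i + 1) ∧
        diagSeq hn r d i ≤ r ⟨i + 1, by omega⟩ + diagSeq hn r d (i + 1) ∧
        diagSeq hn r d (i + 1) ≤ r ⟨i + 1, by omega⟩ + diagSeq hn r d i}

/-- Over a vector `v` one can erect a (possibly degenerate) triangle with any admissible
side lengths. -/
lemma exists_norm_eq_norm_sub_eq {E : Type*} [NormedAddCommGroup E] [NormedSpace ℝ E]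
    (hE : 1 < Module.rank ℝ E) (v : E) {b c : ℝ}
    (h₁ : c ≤ ‖v‖ + b) (h₂ : ‖v‖ ≤ c + b) (h₃ : b ≤ c + ‖v‖) :
    ∃ w : E, ‖w‖ = b ∧ ‖w - v‖ = c := by
  have hb : 0 ≤ b := by linarith
  have : Nontrivial E := by
    rw [← rank_pos_iff_nontrivial (R := ℝ)]
    exact zero_lt_one.trans hE
  obtain ⟨u, hu, huv⟩ : ∃ u : E, ‖u‖ = 1 ∧ v = ‖v‖ • u := by
    rcases eq_or_ne v 0 with rfl | hv
    · obtain ⟨u, hu⟩ := exists_norm_eq E zero_le_one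
      exact ⟨u, hu, by simp⟩
    · refine ⟨‖v‖⁻¹ • v, norm_smul_inv_norm (𝕜 := ℝ) hv, ?_⟩
      rw [smul_inv_smul₀ (norm_ne_zero_iff.mpr hv)]
  have hnear : ‖b • u - v‖ = |b - ‖v‖| := by
    conv_lhs => rw [huv, ← sub_smul, norm_smul, hu, mul_one, Real.norm_eq_abs]
  have hfar : ‖(-b) • u - v‖ = ‖v‖ + b := by
    conv_lhs => rw [huv, ← sub_smul, norm_smul, hu, mul_one, Real.norm_eq_abs]
    rw [abs_of_nonpos (by linarith [norm_nonneg v])]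
    ring
  have hc : c ∈ Set.Icc ‖b • u - v‖ ‖(-b) • u - v‖ := by
    rw [hnear, hfar]
    exact ⟨abs_le.mpr ⟨by linarith, by linarith⟩, h₁⟩
  obtain ⟨w, hw, hwc⟩ := (isPreconnected_sphere hE (0 : E) b).intermediate_value
    (f := fun w => ‖w - v‖) (a := b • u) (b := (-b) • u)
    (by simp [norm_smul, hu, abs_of_nonneg hb]) (by simp [norm_smul, hu, abs_of_nonneg hb])
    (by fun_prop) hc
  exact ⟨w, by simpa using hw, hwc⟩

lemma diagSeq_zero {n : ℕ} (hn : 4 ≤ n) (r : Fin n → ℝ) (d : Fin (n - 3) → ℝ) :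
    diagSeq hn r d 0 = r ⟨0, by omega⟩ := by
  simp [diagSeq]

lemma diagSeq_succ {n : ℕ} (hn : 4 ≤ n) (r : Fin n → ℝ) (d : Fin (n - 3) → ℝ)
    (k : Fin (n - 3)) : diagSeq hn r d (k + 1) = d k := by
  have : (k : ℕ) + 1 < n - 2 := by omega
  simp [diagSeq, this]

lemma diagSeq_last {n : ℕ} (hn : 4 ≤ n) (r : Fin n → ℝ) (d : Fin (n - 3) → ℝ) :
    diagSeq hn r d (n - 2) = r ⟨n - 1, by omega⟩ := by
  have : n - 2 ≠ 0 := by omega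
  simp [diagSeq, this]

/-- The diagonal lengths of a closed polygon, given through its vertices `T 0 = 0, …, T n = 0`,
extend to the sequence of all distances from the vertex `0`. -/
lemma diagSeq_eq_norm {E : Type*} [NormedAddCommGroup E] {n : ℕ} (hn : 4 ≤ n) (r : Fin n → ℝ)
    (T : ℕ → E) (h0 : T 0 = 0) (hT : T n = 0) (hr : ∀ i : Fin n, ‖T (i + 1) - T i‖ = r i)
    {i : ℕ} (hi : i ≤ n - 2) :
    diagSeq hn r (fun k : Fin (n - 3) => ‖T (k + 2)‖) i = ‖T (i + 1)‖ := by
  rcases Nat.eq_zero_or_pos i with rfl | hpos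
  · rw [diagSeq_zero, ← hr]
    simp [h0]
  rcases hi.eq_or_lt with rfl | hlt
  · rw [diagSeq_last, ← hr]
    simp [show n - 1 + 1 = n by omega, show n - 2 + 1 = n - 1 by omega, hT]
  · obtain ⟨k, rfl⟩ : ∃ k, i = k + 1 := ⟨i - 1, by omega⟩
    exact diagSeq_succ hn r _ ⟨k, by omega⟩

theorem stmt12 (n : ℕ) (hn : 4 ≤ n) (r : Fin n → ℝ) (hr : ∀ i, 0 < r i) :
    (fun e : Fin n → EuclideanSpace ℝ (Fin 3) =>
        fun k : Fin (n - 3) =>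
          ‖∑ j : Fin (k.val + 2), e (Fin.castLE (by have := k.isLt; omega) j)‖) ''
      {e : Fin n → EuclideanSpace ℝ (Fin 3) | (∀ i, ‖e i‖ = r i) ∧ ∑ i, e i = 0} =
    DeltaCat hn r := by
  ext d
  constructor
  · rintro ⟨e, ⟨he, hsum⟩, rfl⟩
    set f : ℕ → EuclideanSpace ℝ (Fin 3) := fun i => if h : i < n then e ⟨i, h⟩ else 0 with hf
    have hfe : ∀ i : Fin n, f i = e i := fun i => by simp [hf]
    set T : ℕ → EuclideanSpace ℝ (Fin 3) := fun k => ∑ i ∈ Finset.range k, f i with hTdef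
    have hstep : ∀ i, T (i + 1) = T i + f i := fun i => Finset.sum_range_succ f i
    have hTn : T n = 0 := by
      rw [← hsum, hTdef]
      simp only [← Fin.sum_univ_eq_sum_range, hfe]
    have hdiag : (fun k : Fin (n - 3) =>
        ‖∑ j : Fin (k.val + 2), e (Fin.castLE (by have := k.isLt; omega) j)‖) =
        fun k : Fin (n - 3) => ‖T (k + 2)‖ := by
      funext k
      simp only [hTdef, ← Fin.sum_univ_eq_sum_range, ← hfe, Fin.val_castLE]
    have hnorm : ∀ i : Fin n, ‖T (i + 1) - T i‖ = r i := fun i => by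
      rw [hstep, add_sub_cancel_left, hfe, he]
    intro i hi
    simp only [hdiag]
    rw [diagSeq_eq_norm hn r T (by simp [hTdef]) hTn hnorm (by omega),
      diagSeq_eq_norm hn r T (by simp [hTdef]) hTn hnorm (by omega), ← hnorm]
    have h₁ := norm_sub_le (T (i + 1 + 1)) (T (i + 1))
    have h₂ := norm_le_norm_sub_add (T (i + 1)) (T (i + 1 + 1))
    have h₃ := norm_le_norm_sub_add (T (i + 1 + 1)) (T (i + 1))
    rw [norm_sub_rev] at h₂
    exact ⟨by linarith only [h₁], h₂, h₃⟩
  · intro hd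
    have hE : 1 < Module.rank ℝ (EuclideanSpace ℝ (Fin 3)) := by
      rw [← Module.finrank_eq_rank, finrank_euclideanSpace_fin]
      norm_num
    have hex : ∀ (i : ℕ) (v : EuclideanSpace ℝ (Fin 3)), ∃ w, ∀ hi : i ≤ n - 3,
        ‖v‖ = diagSeq hn r d i →
        ‖w‖ = diagSeq hn r d (i + 1) ∧ ‖w - v‖ = r ⟨i + 1, by omega⟩ := by
      intro i v
      by_cases hi : i ≤ n - 3 ∧ ‖v‖ = diagSeq hn r d i
      · obtain ⟨hi, hv⟩ := hi
        obtain ⟨h₁, h₂, h₃⟩ := hd i hi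
        rw [← hv] at h₁ h₂ h₃
        obtain ⟨w, hw⟩ := exists_norm_eq_norm_sub_eq hE v h₁ h₂ h₃
        exact ⟨w, fun _ _ => hw⟩
      · exact ⟨0, fun hi' hv => absurd ⟨hi', hv⟩ hi⟩
    choose next hnext using hex
    obtain ⟨u, hu⟩ := exists_norm_eq (EuclideanSpace ℝ (Fin 3)) (hr ⟨0, by omega⟩).le
    let s : ℕ → EuclideanSpace ℝ (Fin 3) := fun i => Nat.rec u next i
    have hs : ∀ i ≤ n - 2, ‖s i‖ = diagSeq hn r d i := by
      intro i
      induction i with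
      | zero => exact fun _ => hu.trans (diagSeq_zero hn r d).symm
      | succ i ih => exact fun hi => (hnext i (s i) (by omega) (ih (by omega))).1
    have hs' : ∀ (i : ℕ) (hi : i ≤ n - 3), ‖s (i + 1) - s i‖ = r ⟨i + 1, by omega⟩ :=
      fun i hi => (hnext i (s i) hi (hs i (by omega))).2
    let T : ℕ → EuclideanSpace ℝ (Fin 3) := fun k => if k = 0 ∨ k = n then 0 else s (k - 1)
    have hT0 : T 0 = 0 := by simp [T]
    have hTn : T n = 0 := by simp [T]
    have hTs : ∀ i ≤ n - 2, T (i + 1) = s i := fun i hi => by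
      simp [T, show i + 1 ≠ n by omega]
    have hsum : ∀ m, ∑ j : Fin m, (T (j + 1) - T j) = T m := fun m => by
      rw [Fin.sum_univ_eq_sum_range (fun j => T (j + 1) - T j), Finset.sum_range_sub, hT0, sub_zero]
    refine ⟨fun i => T (i + 1) - T i, ⟨?_, by rw [hsum, hTn]⟩, ?_⟩
    · rintro ⟨i, hi⟩
      rcases i with _ | i
      · simp only [hT0, sub_zero]
        rw [hTs 0 (by omega), hs 0 (by omega), diagSeq_zero]
      rcases (show i + 1 ≤ n - 1 by omega).eq_or_lt with h | h
      · have hi' : i = n - 2 := by omega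
        simp only [show i + 1 + 1 = n by omega, hTn, zero_sub, norm_neg]
        rw [hTs i (by omega), hs i (by omega)]
        subst hi'
        rw [diagSeq_last]
        congr 2
        omega
      · simp only
        rw [hTs (i + 1) (by omega), hTs i (by omega), hs' i (by omega)]
    · funext k
      simp only [Fin.val_castLE]
      rw [hsum, hTs (k + 1) (by omega), hs (k + 1) (by omega), diagSeq_succ]
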